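/- Let q ∈ [2,∞), p ∈ [1,∞) and K > 0. There is a constant C = C(q,p,K) such that for every real Banach space X having cotype q with constant K, every n ∈ ℕ, and all f_1,…,f_n : {-1,1}^n → X, one has E_ε‖Σ_{i=1}^n Δ^{-1} D_i f_i‖_X^p ≤ C · E_{δ,ε}‖Σ_{i=1}^n δ_i f_i(ε)‖_X^p. -/

import Mathlib

open scoped BigOperators
open Finset

noncomputable section

/-- The ±1 value of a Boolean coordinate. -/
def rad (b : Bool) : ℝ := if b then 1 else -1

/-- Expectation over the uniform measure on the discrete cube `{-1,1}^n`
(points encoded as `Fin n → Bool`). -/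
def cubeAvg {n : ℕ} {X : Type*} [AddCommGroup X] [Module ℝ X]
    (f : (Fin n → Bool) → X) : X :=
  ((2 ^ n : ℝ)⁻¹) • ∑ ε : Fin n → Bool, f ε

/-- Walsh character `w_A(ε) = ∏_{i ∈ A} ε_i`. -/
def walshChar {n : ℕ} (A : Finset (Fin n)) (ε : Fin n → Bool) : ℝ :=
  ∏ i ∈ A, rad (ε i)

/-- Walsh coefficient `f̂(A) = E_ε [f(ε) w_A(ε)]`. -/
def wcoef {n : ℕ} {X : Type*} [AddCommGroup X] [Module ℝ X]
    (f : (Fin n → Bool) → X) (A : Finset (Fin n)) : X :=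
  cubeAvg (fun ε => walshChar A ε • f ε)

/-- Flip the `j`-th coordinate. -/
def flipCoord {n : ℕ} (j : Fin n) (ε : Fin n → Bool) : Fin n → Bool :=
  Function.update ε j (!(ε j))

/-- Discrete derivative `D_j f(ε) = (f(ε) - f(σ_j ε))/2`. -/
def Dop {n : ℕ} {X : Type*} [AddCommGroup X] [Module ℝ X]
    (j : Fin n) (f : (Fin n → Bool) → X) : (Fin n → Bool) → X :=
  fun ε => (2 : ℝ)⁻¹ • (f ε - f (flipCoord j ε))

/-- Heat semigroup `P_t f = Σ_A e^{-t|A|} f̂(A) w_A`. -/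
def heatOp {n : ℕ} {X : Type*} [AddCommGroup X] [Module ℝ X]
    (t : ℝ) (f : (Fin n → Bool) → X) : (Fin n → Bool) → X :=
  fun ε => ∑ A : Finset (Fin n), (Real.exp (-t * A.card) * walshChar A ε) • wcoef f A

/-- Fractional power of the Laplacian on mean-zero parts:
`Δ^a f = Σ_{A ≠ ∅} |A|^a f̂(A) w_A`. -/
def lapPow {n : ℕ} {X : Type*} [AddCommGroup X] [Module ℝ X]
    (a : ℝ) (f : (Fin n → Bool) → X) : (Fin n → Bool) → X :=
  fun ε => ∑ A ∈ Finset.univ.filter (fun A : Finset (Fin n) => A ≠ ∅),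
    (((A.card : ℝ)) ^ a * walshChar A ε) • wcoef f A

/-- `X` has cotype `q` with constant `K`. -/
def HasCotypeConst (X : Type*) [NormedAddCommGroup X] [NormedSpace ℝ X] (q K : ℝ) : Prop :=
  ∀ m : ℕ, ∀ x : Fin m → X,
    (∑ j, ‖x j‖ ^ q) ^ (1 / q) ≤
      K * (cubeAvg (fun δ : Fin m → Bool => ‖∑ j, rad (δ j) • x j‖ ^ (2 : ℝ))) ^ (1 / 2 : ℝ)

/-- `X` has type `s` with constant `T`. -/
def HasTypeConst (X : Type*) [NormedAddCommGroup X] [NormedSpace ℝ X] (s T : ℝ) : Prop :=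
  ∀ m : ℕ, ∀ x : Fin m → X,
    (cubeAvg (fun δ : Fin m → Bool => ‖∑ j, rad (δ j) • x j‖ ^ (2 : ℝ))) ^ (1 / 2 : ℝ) ≤
      T * (∑ j, ‖x j‖ ^ s) ^ (1 / s)

/-- Product-weight expectation. -/
def pE {n : ℕ} {κ E : Type*} [Fintype κ] [AddCommGroup E] [Module ℝ E]
    (μ : κ → ℝ) (F : (Fin n → κ) → E) : E :=
  ∑ c : Fin n → κ, (∏ i, μ (c i)) • F c

theorem cubeAvg_eq_pE {n : ℕ} {E : Type*} [AddCommGroup E] [Module ℝ E]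
    (f : (Fin n → Bool) → E) : cubeAvg f = pE (fun _ => (2 : ℝ)⁻¹) f := by
  simp [cubeAvg, pE, Finset.smul_sum]

theorem pE_weight {n : ℕ} {κ : Type*} [Fintype κ] (μ : κ → ℝ) (h1 : ∑ k, μ k = 1) :
    ∑ c : Fin n → κ, (∏ i, μ (c i)) = 1 := by
  classical
  have := Finset.prod_univ_sum (fun _ : Fin n => (Finset.univ : Finset κ)) (fun _ k => μ k)
  simp only [h1, Finset.prod_const_one, Fintype.piFinset_univ] at this
  exact this.symm

theorem pE_const {n : ℕ} {κ E : Type*} [Fintype κ] [AddCommGroup E] [Module ℝ E]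
    (μ : κ → ℝ) (h1 : ∑ k, μ k = 1) (x : E) : pE (n := n) μ (fun _ => x) = x := by
  simp [pE, ← Finset.sum_smul, pE_weight μ h1]

theorem pE_mono {n : ℕ} {κ : Type*} [Fintype κ] (μ : κ → ℝ) (h0 : ∀ k, 0 ≤ μ k)
    {F G : (Fin n → κ) → ℝ} (h : ∀ c, F c ≤ G c) : pE μ F ≤ pE μ G := by
  unfold pE
  exact Finset.sum_le_sum fun c _ =>
    smul_le_smul_of_nonneg_left (h c) (Finset.prod_nonneg fun i _ => h0 _)

theorem pE_nonneg {n : ℕ} {κ : Type*} [Fintype κ] (μ : κ → ℝ) (h0 : ∀ k, 0 ≤ μ k)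
    {F : (Fin n → κ) → ℝ} (h : ∀ c, 0 ≤ F c) : 0 ≤ pE μ F := by
  unfold pE
  exact Finset.sum_nonneg fun c _ =>
    smul_nonneg (Finset.prod_nonneg fun i _ => h0 _) (h c)

theorem pE_sum {n : ℕ} {κ E J : Type*} [Fintype κ] [AddCommGroup E] [Module ℝ E] (s : Finset J)
    (μ : κ → ℝ) (F : J → (Fin n → κ) → E) :
    pE μ (fun c => ∑ j ∈ s, F j c) = ∑ j ∈ s, pE μ (F j) := by
  unfold pE
  simp only [Finset.smul_sum]
  exact Finset.sum_comm

theorem pE_smul {n : ℕ} {κ E : Type*} [Fintype κ] [AddCommGroup E] [Module ℝ E]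
    (μ : κ → ℝ) (a : ℝ) (F : (Fin n → κ) → E) :
    pE μ (fun c => a • F c) = a • pE μ F := by
  unfold pE
  simp only [Finset.smul_sum, smul_comm a]

theorem pE_mul {n : ℕ} {κ : Type*} [Fintype κ]
    (μ : κ → ℝ) (a : ℝ) (F : (Fin n → κ) → ℝ) :
    pE μ (fun c => a * F c) = a * pE μ F := pE_smul μ a F

theorem pE_comm {n m : ℕ} {κ κ' E : Type*} [Fintype κ] [Fintype κ'] [AddCommGroup E] [Module ℝ E]
    (μ : κ → ℝ) (ν : κ' → ℝ) (F : (Fin n → κ) → (Fin m → κ') → E) :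
    pE μ (fun c => pE ν (fun d => F c d)) = pE ν (fun d => pE μ (fun c => F c d)) := by
  unfold pE
  simp only [Finset.smul_sum]
  rw [Finset.sum_comm]
  exact Finset.sum_congr rfl fun d _ => Finset.sum_congr rfl fun c _ => smul_comm _ _ _

theorem pE_jensen {n : ℕ} {κ : Type*} [Fintype κ] (μ : κ → ℝ) (h0 : ∀ k, 0 ≤ μ k)
    (h1 : ∑ k, μ k = 1) {F : (Fin n → κ) → ℝ} (hF : ∀ c, 0 ≤ F c) {p : ℝ} (hp : 1 ≤ p) :
    (pE μ F) ^ p ≤ pE μ (fun c => F c ^ p) := by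
  unfold pE
  simp only [smul_eq_mul]
  exact Real.rpow_arith_mean_le_arith_mean_rpow _ _ _
    (fun c _ => Finset.prod_nonneg fun i _ => h0 _) (pE_weight μ h1) (fun c _ => hF c) hp

theorem pE_norm_le {n : ℕ} {κ X : Type*} [Fintype κ] [NormedAddCommGroup X] [NormedSpace ℝ X]
    (μ : κ → ℝ) (h0 : ∀ k, 0 ≤ μ k) (F : (Fin n → κ) → X) :
    ‖pE μ F‖ ≤ pE μ (fun c => ‖F c‖) := by
  unfold pE
  refine (norm_sum_le _ _).trans (Finset.sum_le_sum fun c _ => ?_)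
  rw [norm_smul, Real.norm_of_nonneg (Finset.prod_nonneg fun i _ => h0 _), smul_eq_mul]

theorem pE_norm_jensen {n : ℕ} {κ X : Type*} [Fintype κ] [NormedAddCommGroup X] [NormedSpace ℝ X]
    (μ : κ → ℝ) (h0 : ∀ k, 0 ≤ μ k) (h1 : ∑ k, μ k = 1) (F : (Fin n → κ) → X)
    {p : ℝ} (hp : 1 ≤ p) :
    ‖pE μ F‖ ^ p ≤ pE μ (fun c => ‖F c‖ ^ p) :=
  (Real.rpow_le_rpow (norm_nonneg _) (pE_norm_le μ h0 F) (by linarith)).trans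
    (pE_jensen μ h0 h1 (fun _ => norm_nonneg _) hp)

theorem pE_push {n : ℕ} {κ β E : Type*} [Fintype κ] [Fintype β] [DecidableEq β]
    [AddCommGroup E] [Module ℝ E] (μ : κ → ℝ) (ν : β → ℝ) (φ : κ → β)
    (h : ∀ b, ν b = ∑ k with φ k = b, μ k) (G : (Fin n → β) → E) :
    pE μ (fun c => G (fun i => φ (c i))) = pE ν G := by
  classical
  unfold pE
  rw [← Finset.sum_fiberwise (s := Finset.univ) (g := fun c : Fin n → κ => fun i => φ (c i))]
  refine Finset.sum_congr rfl fun b _ => ?_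
  simp only [h]
  rw [Finset.prod_univ_sum, Finset.sum_smul]
  refine Finset.sum_congr ?_ fun c hc => ?_
  · ext c
    simp [Fintype.mem_piFinset, funext_iff]
  · have : (fun i => φ (c i)) = b := by
      simpa [Fintype.mem_piFinset, funext_iff] using hc
    rw [this]

theorem pE_prod {n : ℕ} {κ κ' E : Type*} [Fintype κ] [Fintype κ'] [AddCommGroup E] [Module ℝ E]
    (μ : κ → ℝ) (ν : κ' → ℝ) (F : (Fin n → κ) → (Fin n → κ') → E) :
    pE μ (fun c => pE ν (fun d => F c d)) =
      pE (fun k : κ × κ' => μ k.1 * ν k.2) (fun e => F (fun i => (e i).1) (fun i => (e i).2)) := by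
  unfold pE
  simp only [Finset.smul_sum, Finset.prod_mul_distrib, ← mul_smul]
  rw [← Fintype.sum_prod_type']
  exact (Equiv.sum_comp (Equiv.arrowProdEquivProdArrow (Fin n) (fun _ => κ) (fun _ => κ'))
    (fun e : (Fin n → κ) × (Fin n → κ') => ((∏ i, μ (e.1 i)) * ∏ i, ν (e.2 i)) • F e.1 e.2)).symm

theorem pE_coord {n : ℕ} {κ : Type*} [Fintype κ] (μ : κ → ℝ) (h1 : ∑ k, μ k = 1) (i : Fin n)
    (g : κ → ℝ) : pE μ (fun c : Fin n → κ => g (c i)) = ∑ k, μ k * g k := by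
  classical
  unfold pE
  have := Finset.prod_univ_sum (fun _ : Fin n => (Finset.univ : Finset κ))
    (fun j k => μ k * (if j = i then g k else 1))
  simp only [Fintype.piFinset_univ, Finset.prod_mul_distrib, Finset.prod_ite_eq',
    Finset.mem_univ, if_true] at this
  simp only [smul_eq_mul, ← this]
  rw [Finset.prod_eq_single i]
  · simp
  · intro j _ hj
    simp [hj, h1]
  · simp

theorem rad_mul (a b : Bool) : rad a * rad b = rad (a == b) := by
  cases a <;> cases b <;> simp [rad]

theorem rad_sq (a : Bool) : rad a * rad a = 1 := by
  cases a <;> simp [rad]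

theorem rad_not (a : Bool) : rad (!a) = - rad a := by
  cases a <;> simp [rad]

/-- multiplication by a fixed sign vector -/
def mulCube {n : ℕ} (ε : Fin n → Bool) : (Fin n → Bool) ≃ (Fin n → Bool) where
  toFun d := fun i => ε i == d i
  invFun d := fun i => ε i == d i
  left_inv d := by
    funext i
    cases h : ε i <;> cases h' : d i <;> simp [h, h']
  right_inv d := by
    funext i
    cases h : ε i <;> cases h' : d i <;> simp [h, h']

theorem mulCube_apply {n : ℕ} (ε d : Fin n → Bool) (i : Fin n) :
    mulCube ε d i = (ε i == d i) := rfl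

theorem mulCube_comm {n : ℕ} (ε d : Fin n → Bool) : mulCube ε d = mulCube d ε := by
  funext i
  simp [mulCube_apply, Bool.beq_comm]

theorem cubeAvg_mulCube {n : ℕ} {E : Type*} [AddCommGroup E] [Module ℝ E]
    (ε : Fin n → Bool) (f : (Fin n → Bool) → E) :
    cubeAvg (fun d => f (mulCube ε d)) = cubeAvg f := by
  unfold cubeAvg
  rw [Equiv.sum_comp (mulCube ε) f]

theorem flip_invol {n : ℕ} (j : Fin n) : Function.Involutive (flipCoord j) := by
  intro ε
  simp [flipCoord]

theorem cubeAvg_flip {n : ℕ} {E : Type*} [AddCommGroup E] [Module ℝ E]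
    (j : Fin n) (f : (Fin n → Bool) → E) :
    cubeAvg (fun d => f (flipCoord j d)) = cubeAvg f := by
  unfold cubeAvg
  congr 1
  exact Equiv.sum_comp (flip_invol j).toPerm f

theorem walsh_flip {n : ℕ} (j : Fin n) (A : Finset (Fin n)) (ε : Fin n → Bool) :
    walshChar A (flipCoord j ε) = if j ∈ A then - walshChar A ε else walshChar A ε := by
  unfold walshChar flipCoord
  split_ifs with h
  · rw [← Finset.mul_prod_erase _ _ h, ← Finset.mul_prod_erase _ (fun i => rad (ε i)) h]
    simp only [Function.update_self, rad_not, neg_mul]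
    congr 2
    refine Finset.prod_congr rfl fun i hi => ?_
    rw [Function.update_of_ne (Finset.ne_of_mem_erase hi)]
  · refine Finset.prod_congr rfl fun i hi => ?_
    rw [Function.update_of_ne]
    rintro rfl
    exact h hi

theorem wcoef_Dop {n : ℕ} {E : Type*} [AddCommGroup E] [Module ℝ E]
    (j : Fin n) (f : (Fin n → Bool) → E) (A : Finset (Fin n)) :
    wcoef (Dop j f) A = if j ∈ A then wcoef f A else 0 := by
  have key : cubeAvg (fun ε => walshChar A ε • f (flipCoord j ε)) =
      cubeAvg (fun ε => walshChar A (flipCoord j ε) • f ε) := by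
    rw [← cubeAvg_flip j]
    simp only [flip_invol j _]
  have h2 : wcoef (Dop j f) A = (2 : ℝ)⁻¹ • (wcoef f A -
      cubeAvg (fun ε => walshChar A ε • f (flipCoord j ε))) := by
    unfold wcoef Dop cubeAvg
    have : ∀ ε, walshChar A ε • ((2 : ℝ)⁻¹ • (f ε - f (flipCoord j ε))) =
        (2 : ℝ)⁻¹ • (walshChar A ε • f ε - walshChar A ε • f (flipCoord j ε)) := by
      intro ε
      rw [smul_comm, smul_sub]
    simp only [this, ← Finset.smul_sum, Finset.sum_sub_distrib]
    rw [smul_comm, smul_sub]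
  rw [h2, key]
  simp only [walsh_flip]
  split_ifs with h
  · have : cubeAvg (fun ε => -walshChar A ε • f ε) = - wcoef f A := by
      simp [wcoef, cubeAvg]
    rw [this, sub_neg_eq_add, ← two_smul ℝ, smul_smul]
    norm_num
  · simp [wcoef]

theorem walsh_orth {n : ℕ} (ε d : Fin n → Bool) :
    ∑ A : Finset (Fin n), walshChar A ε * walshChar A d = if ε = d then (2 : ℝ) ^ n else 0 := by
  have h : ∑ A : Finset (Fin n), walshChar A ε * walshChar A d =
      ∏ i, (1 + rad (ε i) * rad (d i)) := by
    rw [Finset.prod_one_add]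
    simp [walshChar, Finset.prod_mul_distrib]
  rw [h]
  split_ifs with hh
  · subst hh
    simp [rad_sq]
    norm_num
  · obtain ⟨i, hi⟩ := Function.ne_iff.mp hh
    refine Finset.prod_eq_zero (Finset.mem_univ i) ?_
    revert hi
    cases ε i <;> cases d i <;> simp [rad]

theorem parseval {n : ℕ} (f g : (Fin n → Bool) → ℝ) :
    cubeAvg (fun ε => f ε * g ε) = ∑ A, wcoef f A * wcoef g A := by
  have h : ∀ A, wcoef f A * wcoef g A = ((2 ^ n : ℝ)⁻¹ * (2 ^ n : ℝ)⁻¹) *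
      ∑ ε, ∑ d, (f ε * g d) * (walshChar A ε * walshChar A d) := by
    intro A
    unfold wcoef cubeAvg
    simp only [smul_eq_mul]
    rw [mul_mul_mul_comm, Finset.sum_mul_sum]
    congr 1
    refine Finset.sum_congr rfl fun ε _ => Finset.sum_congr rfl fun d _ => ?_
    ring
  simp only [h, ← Finset.mul_sum]
  rw [Finset.sum_comm]
  have h2 : ∀ ε, ∑ A : Finset (Fin n), ∑ d, (f ε * g d) * (walshChar A ε * walshChar A d) =
      2 ^ n * (f ε * g ε) := by
    intro ε
    rw [Finset.sum_comm]
    simp only [← Finset.mul_sum, walsh_orth]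
    simp [mul_comm]
  simp only [h2, ← Finset.mul_sum]
  unfold cubeAvg
  rw [smul_eq_mul]
  field_simp

theorem walsh_single_zero {n : ℕ} (f : (Fin n → Bool) → ℝ)
    (hf : ∀ ε, f (mulCube (fun _ => false) ε) = f ε) (A : Finset (Fin n)) (hA : A.card = 1) :
    wcoef f A = 0 := by
  obtain ⟨i, rfl⟩ := Finset.card_eq_one.mp hA
  have h : wcoef f {i} = - wcoef f {i} := by
    conv_lhs => unfold wcoef
    rw [← cubeAvg_mulCube (fun _ => false)]
    simp only [hf]
    simp [wcoef, cubeAvg, walshChar, mulCube_apply, rad_not]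
  linarith

theorem rad_sum_flip {n : ℕ} {X : Type*} [NormedAddCommGroup X] [NormedSpace ℝ X] (x : Fin n → X)
    (j : Fin n) (ε : Fin n → Bool) :
    ∑ i, rad (flipCoord j ε i) • x i = ∑ i, rad (ε i) • x i - (2 * rad (ε j)) • x j := by
  rw [eq_sub_iff_add_eq, ← Finset.add_sum_erase _ _ (Finset.mem_univ j),
    ← Finset.add_sum_erase _ (fun i => rad (ε i) • x i) (Finset.mem_univ j)]
  have : ∑ i ∈ Finset.univ.erase j, rad (flipCoord j ε i) • x i =
      ∑ i ∈ Finset.univ.erase j, rad (ε i) • x i := by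
    refine Finset.sum_congr rfl fun i hi => ?_
    rw [flipCoord, Function.update_of_ne (Finset.ne_of_mem_erase hi)]
  rw [this, flipCoord, Function.update_self, rad_not]
  module

theorem kahane {n : ℕ} {X : Type*} [NormedAddCommGroup X] [NormedSpace ℝ X] (x : Fin n → X) :
    cubeAvg (fun ε : Fin n → Bool => ‖∑ i, rad (ε i) • x i‖ ^ 2) ≤
      2 * (cubeAvg (fun ε : Fin n → Bool => ‖∑ i, rad (ε i) • x i‖)) ^ 2 := by
  set f : (Fin n → Bool) → ℝ := fun ε => ‖∑ i, rad (ε i) • x i‖ with hf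
  have hDle : ∀ ε, ∑ i, Dop i f ε ≤ f ε := by
    intro ε
    have h1 : ‖∑ j : Fin n, ∑ i, rad (flipCoord j ε i) • x i‖ ≤ ∑ j, f (flipCoord j ε) :=
      norm_sum_le _ _
    have h2 : ∑ j : Fin n, ∑ i, rad (flipCoord j ε i) • x i =
        ((n : ℝ) - 2) • ∑ i, rad (ε i) • x i := by
      simp only [rad_sum_flip, Finset.sum_sub_distrib, Finset.sum_const, Finset.card_univ,
        Fintype.card_fin, sub_smul, mul_smul, ← Finset.smul_sum, Nat.cast_smul_eq_nsmul]
    rw [h2, norm_smul] at h1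
    have h3 : ((n : ℝ) - 2) * f ε ≤ ∑ j, f (flipCoord j ε) :=
      (mul_le_mul_of_nonneg_right (le_abs_self _) (norm_nonneg _)).trans h1
    have h4 : ∑ i, Dop i f ε = (2 : ℝ)⁻¹ * (n * f ε - ∑ j, f (flipCoord j ε)) := by
      simp [Dop, ← Finset.mul_sum, Finset.sum_sub_distrib]
    rw [h4]
    linarith
  have hf0 : ∀ ε, 0 ≤ f ε := fun ε => norm_nonneg _
  have heven : ∀ ε, f (mulCube (fun _ => false) ε) = f ε := by
    intro ε
    simp only [hf, mulCube_apply, Bool.false_beq, rad_not, neg_smul, Finset.sum_neg_distrib,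
      norm_neg]
  have hE : ∑ A : Finset (Fin n), (A.card : ℝ) * wcoef f A ^ 2 ≤ ∑ A, wcoef f A ^ 2 := by
    have a1 : cubeAvg (fun ε => f ε * f ε) = ∑ A, wcoef f A ^ 2 := by
      rw [parseval]
      simp [sq]
    have a2 : cubeAvg (fun ε => f ε * ∑ i, Dop i f ε) =
        ∑ A : Finset (Fin n), (A.card : ℝ) * wcoef f A ^ 2 := by
      have : cubeAvg (fun ε => f ε * ∑ i, Dop i f ε) =
          ∑ i, cubeAvg (fun ε => f ε * Dop i f ε) := by
        simp only [cubeAvg, Finset.mul_sum, smul_eq_mul]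
        exact Finset.sum_comm
      rw [this]
      simp only [parseval, wcoef_Dop]
      rw [Finset.sum_comm]
      refine Finset.sum_congr rfl fun A _ => ?_
      simp [sq]
    rw [← a1, ← a2]
    simp only [cubeAvg_eq_pE]
    exact pE_mono _ (fun _ => by norm_num)
      fun ε => mul_le_mul_of_nonneg_left (hDle ε) (hf0 ε)
  have a1 : cubeAvg (fun ε => f ε ^ 2) = ∑ A, wcoef f A ^ 2 := by
    simp only [sq, parseval]
  have a3 : wcoef f ∅ = cubeAvg f := by
    simp [wcoef, walshChar]
  have a4 : ∑ A, 2 * wcoef f A ^ 2 ≤ ∑ A : Finset (Fin n), ((A.card : ℝ) * wcoef f A ^ 2 +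
      if A = ∅ then 2 * wcoef f A ^ 2 else 0) := by
    refine Finset.sum_le_sum fun A _ => ?_
    split_ifs with h
    · subst h
      simp
    · rcases Nat.lt_or_ge A.card 2 with h2 | h2
      · have : A.card = 1 := by
          have := Finset.card_pos.mpr (Finset.nonempty_iff_ne_empty.mpr h)
          omega
        rw [walsh_single_zero f heven A this]
        simp
      · have : (2 : ℝ) ≤ A.card := by exact_mod_cast h2
        nlinarith [sq_nonneg (wcoef f A)]
  rw [Finset.sum_add_distrib, ← Finset.mul_sum, Finset.sum_ite_eq' Finset.univ ∅] at a4
  simp only [Finset.mem_univ, if_true, a3] at a4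
  change cubeAvg (fun ε => f ε ^ 2) ≤ 2 * (cubeAvg f) ^ 2
  rw [a1]
  linarith

theorem half_sum : ∑ _k : Bool, (2 : ℝ)⁻¹ = 1 := by
  simp

theorem sum_rpow_le_of_cotype {m : ℕ} (a : Fin m → ℝ) (ha : ∀ k, 0 ≤ a k) (p q : ℝ)
    (hp : 1 ≤ p) (hq : 2 ≤ q) (hm : 1 ≤ m) :
    ∑ k, a k ^ p ≤ (m : ℝ) ^ (1 - p / max p q) * ((∑ k, a k ^ q) ^ (1 / q)) ^ p := by
  have hp0 : 0 < p := by linarith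
  have hq0 : 0 < q := by linarith
  have hm0 : (0 : ℝ) < m := by exact_mod_cast hm
  have hs0 : 0 ≤ ∑ k, a k ^ q := Finset.sum_nonneg fun k _ => Real.rpow_nonneg (ha k) _
  rcases le_or_gt q p with h | h
  · rw [max_eq_left h, div_self hp0.ne', sub_self, Real.rpow_zero, one_mul]
    set S := (∑ k, a k ^ q) ^ (1 / q) with hS
    have hS0 : 0 ≤ S := Real.rpow_nonneg hs0 _
    have hSq : S ^ q = ∑ k, a k ^ q := by
      rw [hS, ← Real.rpow_mul hs0, one_div, inv_mul_cancel₀ hq0.ne', Real.rpow_one]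
    have hle : ∀ k, a k ≤ S := by
      intro k
      rw [← Real.rpow_le_rpow_iff (ha k) hS0 hq0, hSq]
      exact Finset.single_le_sum (f := fun k => a k ^ q)
        (fun k _ => Real.rpow_nonneg (ha k) _) (Finset.mem_univ k)
    have e : ∀ b : ℝ, 0 ≤ b → b ^ p = b ^ q * b ^ (p - q) := by
      intro b hb
      rw [← Real.rpow_add_of_nonneg hb hq0.le (by linarith)]
      congr 1
      ring
    rw [e S hS0, hSq, Finset.sum_mul]
    refine Finset.sum_le_sum fun k _ => ?_
    rw [e _ (ha k)]
    exact mul_le_mul_of_nonneg_left (Real.rpow_le_rpow (ha k) (hle k) (by linarith))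
      (Real.rpow_nonneg (ha k) _)
  · rw [max_eq_right h.le]
    have hJ := Real.rpow_arith_mean_le_arith_mean_rpow (Finset.univ : Finset (Fin m))
      (fun _ => (m : ℝ)⁻¹) (fun k => a k ^ p) (fun _ _ => by positivity)
      (by simp [hm0.ne']) (fun k _ => Real.rpow_nonneg (ha k) _)
      (p := q / p) (by rw [le_div_iff₀ hp0]; linarith)
    have e : ∀ k, (a k ^ p) ^ (q / p) = a k ^ q := by
      intro k
      rw [← Real.rpow_mul (ha k), mul_div_cancel₀ _ hp0.ne']
    simp only [e, ← Finset.mul_sum] at hJ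
    have hA0 : 0 ≤ ∑ k, a k ^ p := Finset.sum_nonneg fun k _ => Real.rpow_nonneg (ha k) _
    have h2 := Real.rpow_le_rpow (by positivity) hJ (show 0 ≤ p / q by positivity)
    rw [← Real.rpow_mul (by positivity), show q / p * (p / q) = 1 by field_simp, Real.rpow_one,
      Real.mul_rpow (by positivity) hs0, Real.inv_rpow hm0.le] at h2
    rw [← Real.rpow_mul hs0, show 1 / q * p = p / q by ring, Real.rpow_sub hm0, Real.rpow_one]
    calc ∑ k, a k ^ p = m * ((m : ℝ)⁻¹ * ∑ k, a k ^ p) := by field_simp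
      _ ≤ m * (((m : ℝ) ^ (p / q))⁻¹ * (∑ k, a k ^ q) ^ (p / q)) :=
        mul_le_mul_of_nonneg_left h2 hm0.le
      _ = _ := by ring

theorem moment_compare {m : ℕ} {X : Type*} [NormedAddCommGroup X] [NormedSpace ℝ X]
    (y : Fin m → X) (p : ℝ) (hp : 1 ≤ p) :
    ((cubeAvg (fun δ : Fin m → Bool => ‖∑ j, rad (δ j) • y j‖ ^ (2 : ℝ))) ^ (1 / 2 : ℝ)) ^ p ≤
      2 ^ p * cubeAvg (fun δ : Fin m → Bool => ‖∑ j, rad (δ j) • y j‖ ^ p) := by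
  have hM0 : 0 ≤ cubeAvg (fun δ : Fin m → Bool => ‖∑ j, rad (δ j) • y j‖ ^ (2 : ℝ)) := by
    rw [cubeAvg_eq_pE]
    exact pE_nonneg _ (fun _ => by norm_num) fun _ => by positivity
  have hE0 : 0 ≤ cubeAvg (fun δ : Fin m → Bool => ‖∑ j, rad (δ j) • y j‖ ^ p) := by
    rw [cubeAvg_eq_pE]
    exact pE_nonneg _ (fun _ => by norm_num) fun _ => by positivity
  rcases le_or_gt 2 p with h | h
  · rw [← Real.rpow_mul hM0]
    have := pE_jensen (n := m) (fun _ : Bool => (2 : ℝ)⁻¹) (fun _ => by norm_num) half_sum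
      (F := fun δ => ‖∑ j, rad (δ j) • y j‖ ^ (2 : ℝ)) (fun _ => by positivity)
      (p := 1 / 2 * p) (by linarith)
    simp only [← cubeAvg_eq_pE] at this
    refine this.trans ?_
    have e : ∀ b : ℝ, 0 ≤ b → (b ^ (2 : ℝ)) ^ (1 / 2 * p) = b ^ p := by
      intro b hb
      rw [← Real.rpow_mul hb]
      congr 1
      ring
    simp only [e _ (norm_nonneg _)]
    have : (1 : ℝ) ≤ 2 ^ p := Real.one_le_rpow (by norm_num) (by linarith)
    nlinarith
  · have hk := kahane y
    have hF0 : 0 ≤ cubeAvg (fun δ : Fin m → Bool => ‖∑ j, rad (δ j) • y j‖) := by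
      rw [cubeAvg_eq_pE]
      exact pE_nonneg _ (fun _ => by norm_num) fun _ => by positivity
    have hJ := pE_jensen (n := m) (fun _ : Bool => (2 : ℝ)⁻¹) (fun _ => by norm_num) half_sum
      (F := fun δ => ‖∑ j, rad (δ j) • y j‖) (fun _ => by positivity) hp
    simp only [← cubeAvg_eq_pE] at hJ
    have h1 : (cubeAvg (fun δ : Fin m → Bool => ‖∑ j, rad (δ j) • y j‖ ^ (2 : ℝ))) ^ (1 / 2 : ℝ) ≤
        2 * cubeAvg (fun δ : Fin m → Bool => ‖∑ j, rad (δ j) • y j‖) := by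
      rw [← Real.sqrt_eq_rpow]
      refine Real.sqrt_le_iff.mpr ⟨by positivity, ?_⟩
      simp only [Real.rpow_two]
      nlinarith [sq_nonneg (cubeAvg (fun δ : Fin m → Bool => ‖∑ j, rad (δ j) • y j‖))]
    calc _ ≤ (2 * cubeAvg (fun δ : Fin m → Bool => ‖∑ j, rad (δ j) • y j‖)) ^ p :=
          Real.rpow_le_rpow (Real.rpow_nonneg hM0 _) h1 (by linarith)
      _ = 2 ^ p * (cubeAvg (fun δ : Fin m → Bool => ‖∑ j, rad (δ j) • y j‖)) ^ p :=
          Real.mul_rpow (by norm_num) hF0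
      _ ≤ _ := mul_le_mul_of_nonneg_left hJ (by positivity)

theorem cotype_p {m : ℕ} {X : Type*} [NormedAddCommGroup X] [NormedSpace ℝ X]
    (q p K : ℝ) (hq : 2 ≤ q) (hp : 1 ≤ p) (hK : 0 < K) (hX : HasCotypeConst X q K)
    (hm : 1 ≤ m) (y : Fin m → X) :
    ∑ k, ‖y k‖ ^ p ≤ ((2 * K) ^ p * (m : ℝ) ^ (1 - p / max p q)) *
      cubeAvg (fun δ : Fin m → Bool => ‖∑ j, rad (δ j) • y j‖ ^ p) := by
  have h1 := sum_rpow_le_of_cotype (fun k => ‖y k‖) (fun _ => norm_nonneg _) p q hp hq hm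
  have h2 := hX m y
  have h3 := moment_compare y p hp
  have hM0 : 0 ≤ cubeAvg (fun δ : Fin m → Bool => ‖∑ j, rad (δ j) • y j‖ ^ (2 : ℝ)) := by
    rw [cubeAvg_eq_pE]
    exact pE_nonneg _ (fun _ => by norm_num) fun _ => by positivity
  have h4 := Real.rpow_le_rpow (by positivity) h2 (show 0 ≤ p by linarith)
  rw [Real.mul_rpow hK.le (Real.rpow_nonneg hM0 _)] at h4
  have hmm : 0 ≤ (m : ℝ) ^ (1 - p / max p q) := by positivity
  have hKp : 0 ≤ K ^ p := by positivity
  calc _ ≤ _ := h1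
    _ ≤ (m : ℝ) ^ (1 - p / max p q) * (K ^ p * (2 ^ p *
        cubeAvg (fun δ : Fin m → Bool => ‖∑ j, rad (δ j) • y j‖ ^ p))) :=
      mul_le_mul_of_nonneg_left (h4.trans (mul_le_mul_of_nonneg_left h3 hKp)) hmm
    _ = _ := by
      rw [Real.mul_rpow (by norm_num) hK.le]
      ring

/-- value of a selected sign -/
def oval : Option Bool → ℝ
  | none => 0
  | some b => rad b

/-- weights of selected signs -/
def ow (θ : ℝ) : Option Bool → ℝ
  | none => 1 - θ
  | some _ => θ / 2

theorem selector {n : ℕ} {X : Type*} [NormedAddCommGroup X] [NormedSpace ℝ X]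
    (q p K : ℝ) (hq : 2 ≤ q) (hp : 1 ≤ p) (hK : 0 < K) (hX : HasCotypeConst X q K)
    (θ : ℝ) (hθ : 0 ≤ θ) (N : ℕ) (hN : N * θ ≤ 1) (x : Fin n → X) :
    N * pE (ow θ) (fun τ => ‖∑ i, oval (τ i) • x i‖ ^ p) ≤
      ((2 * K) ^ p * ((N + 1 : ℕ) : ℝ) ^ (1 - p / max p q)) *
        cubeAvg (fun d : Fin n → Bool => ‖∑ i, rad (d i) • x i‖ ^ p) := by
  set μ : Fin (N + 1) → ℝ := Fin.cons (1 - N * θ) (fun _ => θ) with hμ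
  have hμ0 : ∀ k, 0 ≤ μ k := by
    intro k
    refine Fin.cases ?_ (fun k => ?_) k
    · simp [hμ, hN]
    · simpa [hμ] using hθ
  have hμ1 : ∑ k, μ k = 1 := by
    simp [hμ, Fin.sum_univ_succ]
  set C := (2 * K) ^ p * ((N + 1 : ℕ) : ℝ) ^ (1 - p / max p q) with hC
  set h : Bool → ℝ := fun _ => (2 : ℝ)⁻¹ with hh
  have hh0 : ∀ k, 0 ≤ h k := fun _ => by norm_num [hh]
  have hpush : ∀ k : Fin N, pE (ow θ) (fun τ : Fin n → Option Bool => ‖∑ i, oval (τ i) • x i‖ ^ p) =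
      pE μ (fun c : Fin n → Fin (N + 1) => pE h (fun d : Fin n → Bool =>
        ‖∑ i, (if c i = k.succ then rad (d i) else 0) • x i‖ ^ p)) := by
    intro k
    rw [pE_prod, ← pE_push (fun e : Fin (N + 1) × Bool => μ e.1 * h e.2) (ow θ)
      (fun e => if e.1 = k.succ then some e.2 else none)]
    · congr 1
      funext e
      congr 2
      refine Finset.sum_congr rfl fun i _ => ?_
      by_cases hc : (e i).1 = k.succ <;> simp [hc, oval]
    · have hk : μ k.succ = θ := by simp [hμ]
      intro b
      rw [Finset.sum_filter, Fintype.sum_prod_type]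
      cases b with
      | none =>
        have : ∀ c : Fin (N + 1), (∑ y : Bool, if (if c = k.succ then some y else none) = none
            then μ c * h y else 0) = μ c - if c = k.succ then μ c else 0 := by
          intro c
          by_cases hc : c = k.succ
          · simp [hc]
          · simp [hc, hh]
            ring
        simp only [this, Finset.sum_sub_distrib, hμ1, Finset.sum_ite_eq', Finset.mem_univ, if_true,
          hk, ow]
      | some b =>
        have : ∀ c : Fin (N + 1), (∑ y : Bool, if (if c = k.succ then some y else none) = some b
            then μ c * h y else 0) = if c = k.succ then μ c * 2⁻¹ else 0 := by
          intro c
          by_cases hc : c = k.succ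
          · simp [hc, hh]
          · simp [hc]
        simp only [this, Finset.sum_ite_eq', Finset.mem_univ, if_true, hk, ow]
        ring
  have hstep : ∀ (c : Fin n → Fin (N + 1)) (d : Fin n → Bool),
      ∑ k : Fin N, ‖∑ i, (if c i = k.succ then rad (d i) else 0) • x i‖ ^ p ≤
        C * pE h (fun δ : Fin (N + 1) → Bool => ‖∑ i, rad (mulCube (fun i => δ (c i)) d i) • x i‖ ^ p) := by
    intro c d
    have h1 := cotype_p q p K hq hp hK hX (Nat.succ_pos N)
      (fun k : Fin (N + 1) => ∑ i, (if c i = k then rad (d i) else 0) • x i)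
    rw [Fin.sum_univ_succ] at h1
    have h2 : 0 ≤ ‖∑ i, (if c i = 0 then rad (d i) else 0) • x i‖ ^ p := by positivity
    have h3 : ∀ δ : Fin (N + 1) → Bool,
        ∑ k, rad (δ k) • ∑ i, (if c i = k then rad (d i) else 0) • x i =
          ∑ i, rad (mulCube (fun i => δ (c i)) d i) • x i := by
      intro δ
      simp only [Finset.smul_sum]
      rw [Finset.sum_comm]
      refine Finset.sum_congr rfl fun i _ => ?_
      simp [ite_smul, smul_smul, mulCube_apply, ← rad_mul]
    simp only [h3] at h1
    rw [cubeAvg_eq_pE] at h1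
    refine le_trans ?_ h1
    linarith
  have hlhs : N * pE (ow θ) (fun τ : Fin n → Option Bool => ‖∑ i, oval (τ i) • x i‖ ^ p) =
      pE μ (fun c : Fin n → Fin (N + 1) => pE h (fun d : Fin n → Bool => ∑ k : Fin N,
        ‖∑ i, (if c i = k.succ then rad (d i) else 0) • x i‖ ^ p)) := by
    simp only [pE_sum, ← hpush]
    simp
  rw [hlhs]
  calc _ ≤ pE μ (fun c : Fin n → Fin (N + 1) => pE h (fun d : Fin n → Bool =>
        C * pE h (fun δ : Fin (N + 1) → Bool =>
          ‖∑ i, rad (mulCube (fun i => δ (c i)) d i) • x i‖ ^ p))) :=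
        pE_mono _ hμ0 fun c => pE_mono _ hh0 fun d => hstep c d
    _ = pE μ (fun c : Fin n → Fin (N + 1) => C * pE h (fun δ : Fin (N + 1) → Bool =>
          pE h (fun d : Fin n → Bool =>
          ‖∑ i, rad (mulCube (fun i => δ (c i)) d i) • x i‖ ^ p))) := by
        congr 1
        funext c
        rw [pE_mul, pE_comm]
    _ = pE μ (fun c : Fin n → Fin (N + 1) => C * pE h (fun δ : Fin (N + 1) → Bool =>
          cubeAvg (fun d : Fin n → Bool => ‖∑ i, rad (d i) • x i‖ ^ p))) := by
        congr 1
        funext c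
        congr 2
        funext δ
        rw [← cubeAvg_eq_pE]
        exact cubeAvg_mulCube (fun i => δ (c i)) (fun d => ‖∑ i, rad (d i) • x i‖ ^ p)
    _ = _ := by
        simp only [pE_const h half_sum]
        rw [pE_const μ hμ1]

theorem selector_final {n : ℕ} {X : Type*} [NormedAddCommGroup X] [NormedSpace ℝ X]
    (q p K : ℝ) (hq : 2 ≤ q) (hp : 1 ≤ p) (hK : 0 < K) (hX : HasCotypeConst X q K)
    (θ : ℝ) (hθ : 0 < θ) (hθ1 : θ ≤ 1) (x : Fin n → X) :
    pE (ow θ) (fun τ => ‖∑ i, oval (τ i) • x i‖ ^ p) ≤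
      (2 * (2 * K) ^ p * θ ^ (p / max p q)) *
        cubeAvg (fun d : Fin n → Bool => ‖∑ i, rad (d i) • x i‖ ^ p) := by
  set N := ⌊1 / θ⌋₊ with hN
  have hN1 : 1 ≤ N := by
    rw [hN, Nat.one_le_floor_iff, le_div_iff₀ hθ]
    linarith
  have hN1' : (1 : ℝ) ≤ N := by exact_mod_cast hN1
  have hNθ : N * θ ≤ 1 := by
    rw [← le_div_iff₀ hθ]
    exact Nat.floor_le (by positivity)
  have hN2 : 1 / θ ≤ ((N + 1 : ℕ) : ℝ) := by
    push_cast
    exact (Nat.lt_floor_add_one _).le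
  have hsel := selector q p K hq hp hK hX θ hθ.le N hNθ x
  set E := cubeAvg (fun d : Fin n → Bool => ‖∑ i, rad (d i) • x i‖ ^ p) with hE
  set V := pE (ow θ) (fun τ : Fin n → Option Bool => ‖∑ i, oval (τ i) • x i‖ ^ p) with hV
  have hE0 : 0 ≤ E := by
    rw [hE, cubeAvg_eq_pE]
    exact pE_nonneg _ (fun _ => by norm_num) fun _ => by positivity
  set R := p / max p q with hR
  have hR0 : 0 ≤ R := by
    have : 0 < max p q := lt_max_of_lt_left (by linarith)
    positivity
  have hM0 : (0 : ℝ) < ((N + 1 : ℕ) : ℝ) := by positivity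
  have hpow : ((N + 1 : ℕ) : ℝ) ^ (1 - R) ≤ (2 * N) * θ ^ R := by
    rw [Real.rpow_sub hM0, Real.rpow_one, div_eq_mul_inv]
    refine mul_le_mul (by push_cast; linarith) ?_ (by positivity) (by positivity)
    rw [← Real.inv_rpow hM0.le]
    refine Real.rpow_le_rpow (by positivity) ?_ hR0
    rw [one_div] at hN2
    exact inv_le_of_inv_le₀ hθ hN2
  have hK0 : 0 ≤ (2 * K) ^ p := by positivity
  have h2 : N * V ≤ N * ((2 * (2 * K) ^ p * θ ^ R) * E) := by
    calc _ ≤ _ := hsel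
      _ ≤ ((2 * K) ^ p * ((2 * N) * θ ^ R)) * E := by gcongr
      _ = _ := by ring
  exact le_of_mul_le_mul_left h2 (by linarith)

/-- biased sign weights -/
def bw (ρ : ℝ) (b : Bool) : ℝ := (1 + ρ * rad b) / 2

theorem bw_nonneg {ρ : ℝ} (h0 : 0 ≤ ρ) (h1 : ρ < 1) (b : Bool) : 0 ≤ bw ρ b := by
  cases b <;> simp [bw, rad] <;> linarith

theorem bw_sum (ρ : ℝ) : ∑ b, bw ρ b = 1 := by
  simp [bw, rad]
  ring

theorem symm_lemma {n : ℕ} {X : Type*} [NormedAddCommGroup X] [NormedSpace ℝ X]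
    (p : ℝ) (hp : 1 ≤ p) (ρ : ℝ) (h0 : 0 ≤ ρ) (h1 : ρ < 1) (x : Fin n → X) :
    pE (bw ρ) (fun ξ => ‖∑ i, (rad (ξ i) - ρ) • x i‖ ^ p) ≤
      2 ^ p * pE (ow ((1 - ρ ^ 2) / 2)) (fun τ => ‖∑ i, oval (τ i) • x i‖ ^ p) := by
  have hmean : ∀ i : Fin n, pE (bw ρ) (fun ξ : Fin n → Bool => rad (ξ i)) = ρ := by
    intro i
    rw [pE_coord _ (bw_sum ρ)]
    simp [bw, rad]
    ring
  have hexp : ∀ ξ : Fin n → Bool, ∑ i, (rad (ξ i) - ρ) • x i =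
      pE (bw ρ) (fun ξ' : Fin n → Bool => ∑ i, (rad (ξ i) - rad (ξ' i)) • x i) := by
    intro ξ
    rw [pE_sum]
    refine Finset.sum_congr rfl fun i _ => ?_
    conv_lhs => rw [← hmean i, ← pE_const (n := n) (bw ρ) (bw_sum ρ) (rad (ξ i))]
    unfold pE
    rw [← Finset.sum_sub_distrib, Finset.sum_smul]
    refine Finset.sum_congr rfl fun c _ => ?_
    rw [← smul_sub, smul_assoc]
  calc _ ≤ pE (bw ρ) (fun ξ => pE (bw ρ) (fun ξ' : Fin n → Bool =>
        ‖∑ i, (rad (ξ i) - rad (ξ' i)) • x i‖ ^ p)) := by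
        refine pE_mono _ (bw_nonneg h0 h1) fun ξ => ?_
        rw [hexp]
        exact pE_norm_jensen _ (bw_nonneg h0 h1) (bw_sum ρ) _ hp
    _ = 2 ^ p * pE (ow ((1 - ρ ^ 2) / 2)) (fun τ => ‖∑ i, oval (τ i) • x i‖ ^ p) := by
        rw [pE_prod, ← pE_mul, ← pE_push (fun e : Bool × Bool => bw ρ e.1 * bw ρ e.2)
          (ow ((1 - ρ ^ 2) / 2)) (fun e => if e.1 = e.2 then none else some e.1)]
        · congr 1
          funext e
          have : ∑ i, (rad (e i).1 - rad (e i).2) • x i =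
              (2 : ℝ) • ∑ i, oval (if (e i).1 = (e i).2 then none else some (e i).1) • x i := by
            rw [Finset.smul_sum]
            refine Finset.sum_congr rfl fun i _ => ?_
            rw [smul_smul]
            congr 1
            generalize e i = z
            rcases z with ⟨a, b⟩
            cases a <;> cases b <;> simp [oval, rad] <;> norm_num
          rw [this, norm_smul, Real.mul_rpow (norm_nonneg _) (norm_nonneg _)]
          simp
        · intro b
          rw [Finset.sum_filter, Fintype.sum_prod_type]
          rcases b with _ | b
          · simp [bw, ow, rad]
            ring
          · cases b <;> simp [bw, ow, rad] <;> ring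

theorem kernel_identity {n : ℕ} {X : Type*} [NormedAddCommGroup X] [NormedSpace ℝ X]
    (f : (Fin n → Bool) → X) (i : Fin n) (ε : Fin n → Bool) (ρ : ℝ) (h0 : 0 ≤ ρ) (h1 : ρ < 1) :
    ∑ A : Finset (Fin n), (if i ∈ A then (ρ ^ (A.card - 1) * walshChar A ε) • wcoef f A else 0) =
      (1 - ρ ^ 2)⁻¹ • pE (bw ρ) (fun ξ => (rad (ξ i) - ρ) • f (mulCube ε ξ)) := by
  have hs : (1 - ρ ^ 2) ≠ 0 := by nlinarith
  have hR : pE (bw ρ) (fun ξ => (rad (ξ i) - ρ) • f (mulCube ε ξ)) =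
      ∑ η, ((∏ j, bw ρ (mulCube ε η j)) * (rad (mulCube ε η i) - ρ)) • f η := by
    unfold pE
    rw [← Equiv.sum_comp (mulCube ε)]
    refine Finset.sum_congr rfl fun η _ => ?_
    rw [smul_smul]
    congr 2
    exact (mulCube ε).left_inv η
  have hker : ∀ η : Fin n → Bool,
      ∑ A : Finset (Fin n), (if i ∈ A then ρ ^ (A.card - 1) * walshChar A ε * walshChar A η else 0) =
      rad (mulCube ε η i) * ∏ j ∈ Finset.univ.erase i, (1 + ρ * rad (mulCube ε η j)) := by
    intro η
    have hp := Finset.prod_add (fun j : Fin n => (if j = i then 1 else ρ) * rad (mulCube ε η j))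
      (fun j => if j = i then (0 : ℝ) else 1) Finset.univ
    rw [← Finset.mul_prod_erase _ _ (Finset.mem_univ i)] at hp
    simp only [if_true, add_zero, one_mul, Finset.powerset_univ] at hp
    have e1 : ∏ j ∈ Finset.univ.erase i, (1 + ρ * rad (mulCube ε η j)) =
        ∏ j ∈ Finset.univ.erase i, ((if j = i then 1 else ρ) * rad (mulCube ε η j) +
          if j = i then (0 : ℝ) else 1) := by
      refine Finset.prod_congr rfl fun j hj => ?_
      simp only [if_neg (Finset.ne_of_mem_erase hj)]
      ring
    rw [e1, hp]
    refine Finset.sum_congr rfl fun A _ => ?_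
    split_ifs with hA
    · have e2 : ∏ j ∈ Finset.univ \ A, (if j = i then (0 : ℝ) else 1) = 1 := by
        refine Finset.prod_eq_one fun j hj => ?_
        rw [if_neg]
        rintro rfl
        exact (Finset.mem_sdiff.mp hj).2 hA
      have e3 : ∏ j ∈ A, (if j = i then (1 : ℝ) else ρ) = ρ ^ (A.card - 1) := by
        rw [← Finset.mul_prod_erase _ _ hA, if_pos rfl, one_mul, ← Finset.card_erase_of_mem hA]
        refine Finset.prod_eq_pow_card fun j hj => ?_
        rw [if_neg (Finset.ne_of_mem_erase hj)]
      rw [e2, mul_one, Finset.prod_mul_distrib, e3, mul_assoc]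
      simp only [walshChar, mulCube_apply, ← rad_mul, Finset.prod_mul_distrib]
    · symm
      refine mul_eq_zero_of_right _ (Finset.prod_eq_zero (i := i) ?_ ?_)
      · simp [hA]
      · simp
  have hL : ∑ A : Finset (Fin n), (if i ∈ A then (ρ ^ (A.card - 1) * walshChar A ε) • wcoef f A
      else 0) = ∑ η, ((2 ^ n : ℝ)⁻¹ * (rad (mulCube ε η i) *
        ∏ j ∈ Finset.univ.erase i, (1 + ρ * rad (mulCube ε η j)))) • f η := by
    simp only [← hker, Finset.mul_sum, Finset.sum_smul]
    rw [Finset.sum_comm]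
    refine Finset.sum_congr rfl fun A _ => ?_
    split_ifs with hA
    · unfold wcoef cubeAvg
      rw [smul_smul, Finset.smul_sum]
      refine Finset.sum_congr rfl fun η _ => ?_
      rw [smul_smul]
      congr 1
      ring
    · simp
  rw [hL, hR, Finset.smul_sum]
  refine Finset.sum_congr rfl fun η _ => ?_
  rw [smul_smul]
  congr 1
  rw [← Finset.mul_prod_erase _ _ (Finset.mem_univ i)]
  have hprod : ∏ j ∈ Finset.univ.erase i, bw ρ (mulCube ε η j) =
      (∏ j ∈ Finset.univ.erase i, (1 + ρ * rad (mulCube ε η j))) * (2 ^ (n - 1))⁻¹ := by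
    simp only [bw, div_eq_mul_inv, Finset.prod_mul_distrib]
    simp
  have hn : (2 : ℝ) ^ n = 2 * 2 ^ (n - 1) := by
    rw [← pow_succ']
    congr 1
    have := i.pos
    omega
  rw [hprod, hn]
  generalize ∏ j ∈ Finset.univ.erase i, (1 + ρ * rad (mulCube ε η j)) = P
  have hz := rad_sq (mulCube ε η i)
  unfold bw
  generalize rad (mulCube ε η i) = z at *
  have : (1 + ρ * z) * (z - ρ) = (1 - ρ ^ 2) * z := by
    linear_combination ρ * hz
  field_simp
  linear_combination (-P) * this

theorem G_bound {n : ℕ} {X : Type*} [NormedAddCommGroup X] [NormedSpace ℝ X]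
    (q p K : ℝ) (hq : 2 ≤ q) (hp : 1 ≤ p) (hK : 0 < K) (hX : HasCotypeConst X q K)
    (f : Fin n → (Fin n → Bool) → X) (ρ : ℝ) (h0 : 0 ≤ ρ) (h1 : ρ < 1) :
    cubeAvg (fun ε => ‖∑ i, ∑ A : Finset (Fin n),
      (if i ∈ A then (ρ ^ (A.card - 1) * walshChar A ε) • wcoef (f i) A else 0)‖ ^ p) ≤
      (8 * K * (1 - ρ) ^ (1 / max p q - 1)) ^ p *
        cubeAvg (fun δ : Fin n → Bool => cubeAvg (fun ε => ‖∑ i, rad (δ i) • f i ε‖ ^ p)) := by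
  set W := cubeAvg (fun δ : Fin n → Bool => cubeAvg (fun ε => ‖∑ i, rad (δ i) • f i ε‖ ^ p))
    with hW
  set r := max p q with hr
  have hr1 : 1 ≤ r := le_max_of_le_left hp
  have hp0 : 0 ≤ p := by linarith
  set s := 1 - ρ ^ 2 with hs
  have hs0 : 0 < s := by nlinarith
  have hsρ : 1 - ρ ≤ s := by nlinarith
  have hρ0 : 0 < 1 - ρ := by linarith
  set h : Bool → ℝ := fun _ => (2 : ℝ)⁻¹ with hh
  have hh0 : ∀ k, 0 ≤ h k := fun _ => by norm_num [hh]
  have hb0 := bw_nonneg h0 h1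
  have hW' : W = pE h (fun ε : Fin n → Bool =>
      cubeAvg (fun δ : Fin n → Bool => ‖∑ i, rad (δ i) • f i ε‖ ^ p)) := by
    rw [hW]
    simp only [cubeAvg_eq_pE]
    exact pE_comm _ _ _
  have hW0 : 0 ≤ W := by
    rw [hW]
    simp only [cubeAvg_eq_pE]
    exact pE_nonneg _ hh0 fun _ => pE_nonneg _ hh0 fun _ => by positivity
  have e1 : ∀ ε, ∑ i, ∑ A : Finset (Fin n),
      (if i ∈ A then (ρ ^ (A.card - 1) * walshChar A ε) • wcoef (f i) A else 0) =
      s⁻¹ • pE (bw ρ) (fun ξ => ∑ i, (rad (ξ i) - ρ) • f i (mulCube ε ξ)) := by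
    intro ε
    simp only [kernel_identity _ _ _ ρ h0 h1, pE_sum, Finset.smul_sum]
    rfl
  have e2 : ∀ ε : Fin n → Bool, pE (bw ρ) (fun ξ => ‖∑ i, (rad (ξ i) - ρ) • f i ε‖ ^ p) ≤
      2 ^ p * ((2 * (2 * K) ^ p * s ^ (p / r)) *
        cubeAvg (fun d : Fin n → Bool => ‖∑ i, rad (d i) • f i ε‖ ^ p)) := by
    intro ε
    have hE0 : 0 ≤ cubeAvg (fun d : Fin n → Bool => ‖∑ i, rad (d i) • f i ε‖ ^ p) := by
      rw [cubeAvg_eq_pE]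
      exact pE_nonneg _ hh0 fun _ => by positivity
    refine (symm_lemma p hp ρ h0 h1 (fun i => f i ε)).trans ?_
    refine mul_le_mul_of_nonneg_left ?_ (by positivity)
    refine (selector_final q p K hq hp hK hX (s / 2) (by positivity) (by nlinarith)
      (fun i => f i ε)).trans ?_
    refine mul_le_mul_of_nonneg_right ?_ hE0
    refine mul_le_mul_of_nonneg_left ?_ (by positivity)
    exact Real.rpow_le_rpow (by positivity) (by linarith) (by positivity)
  have hconst : (s⁻¹) ^ p * (2 ^ p * (2 * (2 * K) ^ p * s ^ (p / r))) ≤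
      (8 * K * (1 - ρ) ^ (1 / r - 1)) ^ p := by
    have a1 : (s⁻¹) ^ p * s ^ (p / r) = (s ^ (1 / r - 1)) ^ p := by
      rw [← Real.rpow_neg_one, ← Real.rpow_mul hs0.le, ← Real.rpow_mul hs0.le,
        ← Real.rpow_add hs0]
      congr 1
      ring
    have a2 : (s ^ (1 / r - 1)) ^ p ≤ ((1 - ρ) ^ (1 / r - 1)) ^ p := by
      refine Real.rpow_le_rpow (by positivity) ?_ hp0
      refine Real.rpow_le_rpow_of_nonpos hρ0 hsρ ?_
      rw [sub_nonpos, div_le_one (by linarith)]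
      exact hr1
    have a3 : (2 : ℝ) ≤ 2 ^ p := by
      simpa using Real.rpow_le_rpow_of_exponent_le (x := 2) (by norm_num) hp
    have a4 : (8 * K) ^ p = 2 ^ p * (2 ^ p * (2 * K) ^ p) := by
      rw [← Real.mul_rpow (by norm_num) (by positivity),
        ← Real.mul_rpow (by norm_num) (by positivity)]
      congr 1
      ring
    rw [Real.mul_rpow (x := 8 * K) (by positivity) (by positivity), a4]
    calc _ = 2 ^ p * (2 * (2 * K) ^ p) * ((s⁻¹) ^ p * s ^ (p / r)) := by ring
      _ ≤ 2 ^ p * (2 ^ p * (2 * K) ^ p) * ((1 - ρ) ^ (1 / r - 1)) ^ p := by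
        rw [a1]
        gcongr
  calc _ = pE h (fun ε => (s⁻¹) ^ p *
        ‖pE (bw ρ) (fun ξ => ∑ i, (rad (ξ i) - ρ) • f i (mulCube ε ξ))‖ ^ p) := by
        rw [cubeAvg_eq_pE]
        congr 1
        funext ε
        rw [e1, norm_smul, Real.mul_rpow (norm_nonneg _) (norm_nonneg _),
          Real.norm_of_nonneg (by positivity)]
    _ ≤ pE h (fun ε => (s⁻¹) ^ p *
        pE (bw ρ) (fun ξ => ‖∑ i, (rad (ξ i) - ρ) • f i (mulCube ε ξ)‖ ^ p)) := by
        refine pE_mono _ hh0 fun ε => mul_le_mul_of_nonneg_left ?_ (by positivity)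
        exact pE_norm_jensen _ hb0 (bw_sum ρ) _ hp
    _ = (s⁻¹) ^ p * pE h (fun ε =>
        pE (bw ρ) (fun ξ => ‖∑ i, (rad (ξ i) - ρ) • f i ε‖ ^ p)) := by
        rw [pE_mul, pE_comm]
        conv_rhs => rw [pE_comm]
        congr 2
        funext ξ
        rw [← cubeAvg_eq_pE, ← cubeAvg_eq_pE]
        simp only [fun ε => mulCube_comm ε ξ]
        exact cubeAvg_mulCube ξ (fun ε => ‖∑ i, (rad (ξ i) - ρ) • f i ε‖ ^ p)
    _ ≤ (s⁻¹) ^ p * pE h (fun ε => 2 ^ p * ((2 * (2 * K) ^ p * s ^ (p / r)) *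
        cubeAvg (fun d : Fin n → Bool => ‖∑ i, rad (d i) • f i ε‖ ^ p))) :=
        mul_le_mul_of_nonneg_left (pE_mono _ hh0 e2) (by positivity)
    _ = ((s⁻¹) ^ p * (2 ^ p * (2 * (2 * K) ^ p * s ^ (p / r)))) * W := by
        rw [pE_mul, pE_mul, hW']
        ring
    _ ≤ _ := mul_le_mul_of_nonneg_right hconst hW0

theorem integral_weight (r : ℝ) (hr : 1 ≤ r) :
    IntervalIntegrable (fun ρ : ℝ => (1 - ρ) ^ (1 / r - 1)) MeasureTheory.volume 0 1 ∧
      ∫ ρ in (0 : ℝ)..1, (1 - ρ) ^ (1 / r - 1) = r := by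
  have hr0 : 0 < 1 / r := by positivity
  have hi : IntervalIntegrable (fun x : ℝ => x ^ (1 / r - 1)) MeasureTheory.volume 0 1 :=
    intervalIntegral.intervalIntegrable_rpow' (by linarith)
  constructor
  · have := (hi.comp_sub_left 1).symm
    simpa using this
  · rw [intervalIntegral.integral_comp_sub_left (fun x : ℝ => x ^ (1 / r - 1)) 1]
    rw [sub_self, sub_zero, integral_rpow (Or.inl (by linarith))]
    simp [Real.zero_rpow (show r ≠ 0 by linarith), show r⁻¹ ≠ 0 by positivity]

/-- `E‖Σ Δ⁻¹ D_i f_i‖^p ≤ C E‖Σ δ_i f_i‖^p` for cotype-`q` spaces. -/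
theorem riesz_below_lapinv_cotype.{u} (q p K : ℝ) (hq : 2 ≤ q) (hp : 1 ≤ p) (hK : 0 < K) :
    ∃ C : ℝ, ∀ (X : Type u) [NormedAddCommGroup X] [NormedSpace ℝ X] [CompleteSpace X],
      HasCotypeConst X q K →
      ∀ (n : ℕ) (f : Fin n → (Fin n → Bool) → X),
        cubeAvg (fun ε => ‖∑ i, lapPow (-1) (Dop i (f i)) ε‖ ^ p) ≤
          C * cubeAvg (fun δ : Fin n → Bool => cubeAvg (fun ε =>
            ‖∑ i, rad (δ i) • f i ε‖ ^ p)) := by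
  refine ⟨(8 * K * max p q) ^ p, ?_⟩
  intro X _ _ _ hX n f
  set W := cubeAvg (fun δ : Fin n → Bool => cubeAvg (fun ε => ‖∑ i, rad (δ i) • f i ε‖ ^ p))
    with hW
  have hp0 : 0 < p := by linarith
  have hr1 : 1 ≤ max p q := le_max_of_le_left hp
  have hW0 : 0 ≤ W := by
    rw [hW]
    simp only [cubeAvg_eq_pE]
    exact pE_nonneg _ (fun _ => by norm_num) fun _ =>
      pE_nonneg _ (fun _ => by norm_num) fun _ => by positivity
  have htoReal : (ENNReal.ofReal p).toReal = p := ENNReal.toReal_ofReal hp0.le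
  haveI : Fact (1 ≤ ENNReal.ofReal p) := ⟨by simpa using hp⟩
  let v : Fin n → Finset (Fin n) → PiLp (ENNReal.ofReal p) (fun _ : Fin n → Bool => X) :=
    fun i A => WithLp.toLp _ (fun ε => walshChar A ε • wcoef (f i) A)
  let G : ℝ → PiLp (ENNReal.ofReal p) (fun _ : Fin n → Bool => X) := fun ρ =>
    ∑ i, ∑ A : Finset (Fin n), (if i ∈ A then ρ ^ (A.card - 1) else 0) • v i A
  have hGapp : ∀ ρ ε, G ρ ε = ∑ i, ∑ A : Finset (Fin n),
      (if i ∈ A then (ρ ^ (A.card - 1) * walshChar A ε) • wcoef (f i) A else 0) := by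
    intro ρ ε
    simp only [G, v, WithLp.ofLp_sum, Finset.sum_apply, PiLp.smul_apply]
    refine Finset.sum_congr rfl fun i _ => Finset.sum_congr rfl fun A _ => ?_
    split_ifs <;> simp [smul_smul]
  have hnorm : ∀ g : PiLp (ENNReal.ofReal p) (fun _ : Fin n → Bool => X),
      ‖g‖ = (2 ^ n * cubeAvg (fun ε => ‖g ε‖ ^ p)) ^ (1 / p) := by
    intro g
    rw [PiLp.norm_eq_sum (by rw [htoReal]; exact hp0), htoReal]
    congr 1
    simp [cubeAvg]
  have hav0 : ∀ g : PiLp (ENNReal.ofReal p) (fun _ : Fin n → Bool => X),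
      0 ≤ 2 ^ n * cubeAvg (fun ε => ‖g ε‖ ^ p) := by
    intro g
    rw [cubeAvg_eq_pE]
    exact mul_nonneg (by positivity) (pE_nonneg _ (fun _ => by norm_num) fun _ => by positivity)
  have hGb : ∀ ρ ∈ Set.Ico (0 : ℝ) 1, ‖G ρ‖ ≤
      (8 * K * (2 ^ n * W) ^ (1 / p)) * (1 - ρ) ^ (1 / max p q - 1) := by
    intro ρ hρ
    have hb := G_bound q p K hq hp hK hX f ρ hρ.1 hρ.2
    simp only [← hGapp, ← hW] at hb
    have h1ρ : 0 ≤ 1 - ρ := by linarith [hρ.2]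
    have hc0 : 0 ≤ 8 * K * (1 - ρ) ^ (1 / max p q - 1) := by positivity
    rw [hnorm]
    calc _ ≤ ((8 * K * (1 - ρ) ^ (1 / max p q - 1)) ^ p * (2 ^ n * W)) ^ (1 / p) := by
          refine Real.rpow_le_rpow (hav0 _) ?_ (by positivity)
          calc _ ≤ 2 ^ n * ((8 * K * (1 - ρ) ^ (1 / max p q - 1)) ^ p * W) :=
                mul_le_mul_of_nonneg_left hb (by positivity)
            _ = _ := by ring
      _ = _ := by
          rw [Real.mul_rpow (by positivity) (by positivity), ← Real.rpow_mul hc0,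
            mul_one_div_cancel hp0.ne', Real.rpow_one]
          ring
  have hint : ∫ ρ in (0 : ℝ)..1, G ρ = ∑ i, ∑ A : Finset (Fin n),
      (if i ∈ A then (A.card : ℝ)⁻¹ else 0) • v i A := by
    have hcont : ∀ (i : Fin n) (A : Finset (Fin n)),
        Continuous (fun ρ : ℝ => (if i ∈ A then ρ ^ (A.card - 1) else 0) • v i A) := by
      intro i A
      split_ifs
      · fun_prop
      · fun_prop
    simp only [G]
    rw [intervalIntegral.integral_finsetSum fun i _ =>
      (continuous_finsetSum _ fun A _ => hcont i A).intervalIntegrable _ _]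
    refine Finset.sum_congr rfl fun i _ => ?_
    rw [intervalIntegral.integral_finsetSum fun A _ => (hcont i A).intervalIntegrable _ _]
    refine Finset.sum_congr rfl fun A _ => ?_
    rw [intervalIntegral.integral_smul_const]
    congr 1
    split_ifs with hA
    · rw [integral_pow]
      have hc : 0 < A.card := Finset.card_pos.mpr ⟨i, hA⟩
      have : ((A.card - 1 : ℕ) : ℝ) + 1 = A.card := by
        rw [Nat.cast_pred hc]
        ring
      rw [this]
      simp
    · simp
  have hF : ∀ ε, (∫ ρ in (0 : ℝ)..1, G ρ) ε = ∑ i, lapPow (-1) (Dop i (f i)) ε := by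
    intro ε
    rw [hint]
    simp only [v, WithLp.ofLp_sum, Finset.sum_apply, PiLp.smul_apply, lapPow]
    refine Finset.sum_congr rfl fun i _ => ?_
    rw [Finset.sum_filter]
    refine Finset.sum_congr rfl fun A _ => ?_
    rw [wcoef_Dop]
    by_cases hA : i ∈ A
    · have : A ≠ ∅ := Finset.ne_empty_of_mem hA
      simp [hA, this, smul_smul, Real.rpow_neg_one]
    · simp [hA]
  obtain ⟨hwi, hwv⟩ := integral_weight (max p q) hr1
  have hle : ‖∫ ρ in (0 : ℝ)..1, G ρ‖ ≤ (8 * K * (2 ^ n * W) ^ (1 / p)) * max p q := by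
    have := intervalIntegral.norm_integral_le_of_norm_le (f := G) (a := 0) (b := 1)
      (μ := MeasureTheory.volume)
      (g := fun ρ => (8 * K * (2 ^ n * W) ^ (1 / p)) * (1 - ρ) ^ (1 / max p q - 1))
      zero_le_one ?_ (hwi.const_mul _)
    · rwa [intervalIntegral.integral_const_mul, hwv] at this
    · have hne : ∀ᵐ ρ : ℝ, ρ ≠ 1 := by
        simp [MeasureTheory.ae_iff]
      filter_upwards [hne] with ρ hρ hρ'
      exact hGb ρ ⟨hρ'.1.le, lt_of_le_of_ne hρ'.2 hρ⟩
  rw [hnorm] at hle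
  have hle2 := Real.rpow_le_rpow (Real.rpow_nonneg (hav0 _) _) hle hp0.le
  rw [← Real.rpow_mul (hav0 _), one_div_mul_cancel hp0.ne', Real.rpow_one,
    show 8 * K * (2 ^ n * W) ^ (1 / p) * max p q = (8 * K * max p q) * (2 ^ n * W) ^ (1 / p) by ring,
    Real.mul_rpow (by positivity) (by positivity), ← Real.rpow_mul (by positivity),
    one_div_mul_cancel hp0.ne', Real.rpow_one] at hle2
  simp only [hF] at hle2
  refine le_of_mul_le_mul_left (a := (2 : ℝ) ^ n) ?_ (by positivity)
  calc _ ≤ _ := hle2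
    _ = _ := by ring

end
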